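/- arXiv:1407.5374 — 2 statements merged into one kernel-verified Lean document; each statement's English description precedes it below -/
import Mathlib

section
/- Let G be a finite simple graph with maximum degree at most Δ, let e be an edge of G, and let k ≥ 2 be an integer. Then the number of cycles of G of length 2k that contain the edge e is at most (Δ-1)^{2k-2}, where cycles are counted as subgraphs (i.e., two cycles are the same if they have the same edge set). -/
theorem aux_count {V : Type*} [Fintype V] [DecidableEq V]
    (G : SimpleGraph V) [DecidableRel G.Adj] (Δ : ℕ)
    (hdeg : ∀ v, G.degree v ≤ Δ) (t : V) (n : ℕ) : ∀ a b : V, G.Adj a b →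
    ∃ F : Finset (List (Sym2 V)), F.card ≤ (Δ - 1) ^ n ∧
      ∀ p : G.Walk b t, p.edges.Nodup → s(a, b) ∉ p.edges → p.length = n + 1 → p.edges ∈ F := by
  induction n with
  | zero =>
    intro a b _
    refine ⟨{[s(b, t)]}, by simp, ?_⟩
    intro p _ _ hl
    cases p with
    | nil => simp at hl
    | cons h q =>
      cases q with
      | nil => simp
      | cons h' q => simp at hl
  | succ n ih =>
    intro a b hab
    have ih' : ∀ c : V, ∃ F : Finset (List (Sym2 V)), F.card ≤ (Δ - 1) ^ n ∧
        ∀ p : G.Walk c t, G.Adj b c → p.edges.Nodup → s(b, c) ∉ p.edges →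
          p.length = n + 1 → p.edges ∈ F := by
      intro c
      by_cases hc : G.Adj b c
      · obtain ⟨F, h1, h2⟩ := ih b c hc
        exact ⟨F, h1, fun p _ => h2 p⟩
      · exact ⟨∅, by simp, fun p h => absurd h hc⟩
    choose F hF1 hF2 using ih'
    refine ⟨((G.neighborFinset b).erase a).biUnion
      (fun c => (F c).image (fun l => s(b, c) :: l)), ?_, ?_⟩
    · have h1 : ((G.neighborFinset b).erase a).card ≤ Δ - 1 := by
        rw [Finset.card_erase_of_mem (by simpa using hab.symm), G.card_neighborFinset_eq_degree]
        exact Nat.sub_le_sub_right (hdeg b) 1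
      refine (Finset.card_biUnion_le_card_mul _ _ ((Δ - 1) ^ n)
        (fun c _ => Finset.card_image_le.trans (hF1 c))).trans ?_
      rw [pow_succ, mul_comm]
      exact Nat.mul_le_mul_left _ h1
    · intro p hp hn hl
      cases p with
      | nil => simp at hl
      | @cons _ c _ h q =>
        simp only [SimpleGraph.Walk.edges_cons, List.nodup_cons, List.mem_cons, not_or] at hp hn
        simp only [SimpleGraph.Walk.length_cons] at hl
        simp only [Finset.mem_biUnion, Finset.mem_image, SimpleGraph.Walk.edges_cons]
        refine ⟨c, ?_, q.edges, hF2 c q h hp.2 hp.1 (by omega), rfl⟩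
        simp only [Finset.mem_erase, SimpleGraph.mem_neighborFinset]
        refine ⟨?_, h⟩
        rintro rfl
        exact hn.1 Sym2.eq_swap

theorem aux_split {V : Type*} (G : SimpleGraph V) (a b : V) {u v : V} (p : G.Walk u v)
    (h : s(a, b) ∈ p.edges) :
    (∃ (p1 : G.Walk u a) (p2 : G.Walk b v), p.edges = p1.edges ++ s(a, b) :: p2.edges) ∨
    (∃ (p1 : G.Walk u b) (p2 : G.Walk a v), p.edges = p1.edges ++ s(a, b) :: p2.edges) := by
  induction p with
  | nil => simp at h
  | @cons u w v hadj q ih =>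
    rw [SimpleGraph.Walk.edges_cons, List.mem_cons] at h
    rcases h with h | h
    · rcases Sym2.eq_iff.1 h with ⟨rfl, rfl⟩ | ⟨rfl, rfl⟩
      · exact Or.inl ⟨.nil, q, by simp⟩
      · exact Or.inr ⟨.nil, q, by simp [Sym2.eq_swap]⟩
    · rcases ih h with ⟨p1, p2, e⟩ | ⟨p1, p2, e⟩
      · exact Or.inl ⟨.cons hadj p1, p2, by simp [e]⟩
      · exact Or.inr ⟨.cons hadj p1, p2, by simp [e]⟩

theorem aux_open {V : Type*} (G : SimpleGraph V) (a b : V) {v : V} (c : G.Walk v v)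
    (h : s(a, b) ∈ c.edges) :
    ∃ q : G.Walk b a, c.edges.Perm (s(a, b) :: q.edges) := by
  rcases aux_split G a b c h with ⟨p1, p2, e⟩ | ⟨p1, p2, e⟩
  · refine ⟨p2.append p1, ?_⟩
    rw [e, SimpleGraph.Walk.edges_append]
    exact List.perm_append_comm
  · refine ⟨(p2.append p1).reverse, ?_⟩
    rw [e, SimpleGraph.Walk.edges_reverse, SimpleGraph.Walk.edges_append]
    exact List.perm_append_comm.trans ((List.reverse_perm _).symm.cons _)


/-- In a finite simple graph of maximum degree at most `Δ`, the number of
cycles of length `2k` (`k ≥ 2`) containing a fixed edge `e`, where cycles are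
identified with their edge sets, is at most `(Δ-1)^(2k-2)`. -/
theorem cycles_through_edge_bound {V : Type*} [Fintype V] [DecidableEq V]
    (G : SimpleGraph V) [DecidableRel G.Adj] (Δ : ℕ)
    (hdeg : ∀ v, G.degree v ≤ Δ) (k : ℕ) (hk : 2 ≤ k)
    (e : Sym2 V) (he : e ∈ G.edgeSet) :
    Set.ncard {s : Finset (Sym2 V) | ∃ (v : V) (c : G.Walk v v),
        c.IsCycle ∧ c.length = 2 * k ∧ e ∈ c.edges ∧ s = c.edges.toFinset} ≤
      (Δ - 1) ^ (2 * k - 2) := by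
  induction e using Sym2.ind with
  | _ a b =>
  obtain ⟨F, hF1, hF2⟩ := aux_count G Δ hdeg a (2 * k - 2) a b he
  refine le_trans ?_ hF1
  refine le_trans (Set.ncard_le_ncard (t := ((F.image
    (fun l => (s(a, b) :: l).toFinset) : Finset (Finset (Sym2 V))) : Set (Finset (Sym2 V))))
    ?_ (Finset.finite_toSet _)) ?_
  · rintro s ⟨v, c, hc, hl, hm, rfl⟩
    obtain ⟨q, hq⟩ := aux_open G a b c hm
    have hnd := (hq.nodup_iff).1 hc.isTrail.edges_nodup
    rw [List.nodup_cons] at hnd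
    have hlen := hq.length_eq
    simp only [List.length_cons, SimpleGraph.Walk.length_edges] at hlen
    rw [Finset.mem_coe, Finset.mem_image]
    exact ⟨q.edges, hF2 q hnd.2 hnd.1 (by omega), (List.toFinset_eq_of_perm _ _ hq).symm⟩
  · rw [Set.ncard_coe_finset]
    exact Finset.card_image_le
end

section
/- Every finite simple graph G with maximum degree Δ admits an acyclic edge coloring using at most ⌈3.74(Δ-1)⌉ + 1 colors; that is, there is a proper edge coloring of G with ⌈3.74(Δ-1)⌉ + 1 colors under which every cycle of G receives at least three distinct colors on its edges. -/
/-- `col` is a proper edge coloring of `G`: distinct edges sharing an endpoint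
receive distinct colors. -/
def IsProperEdgeColoring {V : Type*} (G : SimpleGraph V) (col : Sym2 V → ℕ) : Prop :=
  ∀ e₁ ∈ G.edgeSet, ∀ e₂ ∈ G.edgeSet, e₁ ≠ e₂ → (∃ v, v ∈ e₁ ∧ v ∈ e₂) →
    col e₁ ≠ col e₂


namespace AEC
open Finset Function
open scoped Classical
set_option linter.unusedSectionVars false
set_option linter.unusedDecidableInType false
set_option linter.unusedFintypeInType false

noncomputable section

variable {V : Type*} [Fintype V] [DecidableEq V] {K : ℕ}

/-- Partial edge colorings. -/
abbrev PCol (V : Type*) (K : ℕ) := Sym2 V → Option (Fin K)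

/-- Proper, supported on `G`, and without bichromatic 4-cycles. -/
structure Good (G : SimpleGraph V) (φ : PCol V K) : Prop where
  supp : ∀ e, φ e ≠ none → e ∈ G.edgeSet
  proper : ∀ a b c x, φ s(a, b) = some x → φ s(a, c) = some x → b = c
  four : ∀ a b c d x y, φ s(a, b) = some x → φ s(b, c) = some y → φ s(c, d) = some x →
    φ s(d, a) = some y → a = c ∨ b = d

/-- There is a bichromatic cycle of length at least 6 with all edges in `H`. -/
def HasLong (H : Finset (Sym2 V)) (φ : PCol V K) : Prop :=
  ∃ (k : ℕ) (p : ℤ → V) (c d : Fin K), 3 ≤ k ∧ (∀ i, p (i + 2 * k) = p i) ∧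
    (∀ i j, p i = p j → (2 * k : ℤ) ∣ i - j) ∧
    (∀ i, s(p i, p (i + 1)) ∈ H ∧
      φ s(p i, p (i + 1)) = some (if Even i then d else c))

/-- Alternating trail from `p` to `v` in `H`, with `j + 1` edges, first color `x`. -/
def PathTo (φ : PCol V K) (v : V) : ℕ → Finset (Sym2 V) → V → Fin K → Fin K → Prop
  | 0, H, p, x, _ => s(p, v) ∈ H ∧ φ s(p, v) = some x
  | j + 1, H, p, x, y => ∃ q, s(p, q) ∈ H ∧ φ s(p, q) = some x ∧
      PathTo φ v j (H.erase s(p, q)) q y x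

/-- The class of colorings of `H` extending the precoloring `π`. -/
def Cls (G : SimpleGraph V) (H : Finset (Sym2 V)) (π : PCol V K) : Finset (PCol V K) :=
  univ.filter fun φ => (∀ e, e ∉ H → φ e = π e) ∧ (∀ e ∈ H, φ e ≠ none) ∧ Good G φ ∧
    ¬ HasLong H φ

lemma mem_Cls {G : SimpleGraph V} {H : Finset (Sym2 V)} {π φ : PCol V K} :
    φ ∈ Cls G H π ↔ (∀ e, e ∉ H → φ e = π e) ∧ (∀ e ∈ H, φ e ≠ none) ∧ Good G φ ∧
    ¬ HasLong H φ := by simp [Cls]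

lemma HasLong.mono {H H' : Finset (Sym2 V)} {φ φ' : PCol V K} (h : H ⊆ H')
    (hφ : ∀ e ∈ H, φ' e = φ e) (hl : HasLong H φ) : HasLong H' φ' := by
  obtain ⟨k, p, c, d, hk, h1, h2, h3⟩ := hl
  exact ⟨k, p, c, d, hk, h1, h2, fun i => ⟨h (h3 i).1, by rw [hφ _ (h3 i).1]; exact (h3 i).2⟩⟩

lemma PathTo.congr {φ φ' : PCol V K} {v : V} : ∀ {j : ℕ} {H : Finset (Sym2 V)} {p : V}
    {x y : Fin K}, (∀ e ∈ H, φ' e = φ e) → PathTo φ v j H p x y → PathTo φ' v j H p x y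
  | 0, H, p, x, y, h, hp => ⟨hp.1, by rw [h _ hp.1]; exact hp.2⟩
  | j + 1, H, p, x, y, h, hp => by
      obtain ⟨q, h1, h2, h3⟩ := hp
      exact ⟨q, h1, by rw [h _ h1]; exact h2, h3.congr fun e he => h e (mem_of_mem_erase he)⟩

lemma PathTo.card {φ : PCol V K} {v : V} : ∀ {j : ℕ} {H : Finset (Sym2 V)} {p : V}
    {x y : Fin K}, PathTo φ v j H p x y → j < H.card
  | 0, H, p, x, y, hp => Finset.card_pos.2 ⟨_, hp.1⟩
  | j + 1, H, p, x, y, hp => by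
      obtain ⟨q, h1, h2, h3⟩ := hp
      have := h3.card
      rw [card_erase_of_mem h1] at this
      omega

/-- A vertex path gives a trail. -/
lemma PathTo.of_fun {φ : PCol V K} : ∀ (j : ℕ) (H : Finset (Sym2 V)) (p : ℕ → V)
    (x y : Fin K), (∀ i ≤ j + 1, ∀ i' ≤ j + 1, p i = p i' → i = i') →
    (∀ i ≤ j, s(p i, p (i + 1)) ∈ H ∧ φ s(p i, p (i + 1)) = some (if Even i then x else y)) →
    PathTo φ (p (j + 1)) j H (p 0) x y
  | 0, H, p, x, y, hi, h => by simpa [PathTo] using h 0 le_rfl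
  | j + 1, H, p, x, y, hi, h => by
      refine ⟨p 1, by simpa using (h 0 (by omega)).1, by simpa using (h 0 (by omega)).2, ?_⟩
      refine PathTo.of_fun j _ (fun i => p (i + 1)) y x ?_ ?_
      · intro i h1 i' h2 h3
        have := hi (i + 1) (by omega) (i' + 1) (by omega) h3
        omega
      · intro i h1
        have h2 := h (i + 1) (by omega)
        refine ⟨mem_erase.2 ⟨?_, h2.1⟩, ?_⟩
        · intro h3
          rw [Sym2.eq_iff] at h3
          rcases h3 with ⟨h3, h4⟩ | ⟨h3, h4⟩
          · have := hi _ (by omega) _ (by omega) h3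
            omega
          · have := hi _ (by omega) _ (by omega) h4
            omega
        · rw [h2.2]
          by_cases h5 : Even i <;> simp [h5, Nat.even_add_one]

lemma HasLong.trail {H : Finset (Sym2 V)} {φ : PCol V K} {u v : V} {c : Fin K}
    (hl : HasLong H φ) (hn : ¬ HasLong (H.erase s(u, v)) φ) (hc : φ s(u, v) = some c) :
    ∃ (l : ℕ) (d : Fin K), PathTo φ v (2 * l + 4) (H.erase s(u, v)) u d c := by
  obtain ⟨k, p, c', d', hk, h1, h2, h3⟩ := hl
  have : ∃ j, s(p j, p (j + 1)) = s(u, v) := by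
    by_contra hcon
    push Not at hcon
    exact hn ⟨k, p, c', d', hk, h1, h2, fun i => ⟨mem_erase.2 ⟨hcon i, (h3 i).1⟩, (h3 i).2⟩⟩
  -- a normalized function
  have key : ∃ (p : ℤ → V) (d : Fin K), (∀ i, p (i + 2 * k) = p i) ∧
    (∀ i j, p i = p j → (2 * k : ℤ) ∣ i - j) ∧
    (∀ i, s(p i, p (i + 1)) ∈ H ∧
      φ s(p i, p (i + 1)) = some (if Even i then d else c)) ∧ p 0 = u ∧ p (-1) = v := by
    obtain ⟨j, hj⟩ := this
    have hcj : c = if Even j then d' else c' := by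
      have := (h3 j).2
      rw [hj, hc] at this
      exact Option.some.inj this
    have hj' := hj
    rw [Sym2.eq_iff] at hj
    rcases hj with ⟨ha, hb⟩ | ⟨ha, hb⟩
    · -- reverse
      refine ⟨fun i => p (j - i), if Even j then c' else d', ?_, ?_, ?_, by simpa using ha,
        by simpa using hb⟩
      · intro i
        have := h1 (j - (i + 2 * k))
        show p (j - (i + 2 * k)) = p (j - i)
        rw [← this]; congr 1; ring
      · intro a b hab
        have := h2 _ _ hab
        have e : a - b = -((j - a) - (j - b)) := by ring
        rw [e]; exact (dvd_neg).2 this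
      · intro i
        have := h3 (j - (i + 1))
        have e : j - (i + 1) + 1 = j - i := by ring
        rw [e, Sym2.eq_swap] at this
        refine ⟨this.1, ?_⟩
        rw [this.2, hcj]
        by_cases h : Even i <;> by_cases h' : Even j <;> simp [h, h', Int.even_sub, Int.even_add_one]
    · refine ⟨fun i => p (j + 1 + i), if Even j then c' else d', ?_, ?_, ?_, by simpa using hb,
        by simpa using ha⟩
      · intro i
        show p (j + 1 + (i + 2 * k)) = p (j + 1 + i)
        rw [← h1 (j + 1 + i)]; congr 1; ring
      · intro a b hab
        have := h2 _ _ hab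
        have e : a - b = ((j + 1 + a) - (j + 1 + b)) := by ring
        rw [e]; exact this
      · intro i
        have := h3 (j + 1 + i)
        have e : j + 1 + i + 1 = j + 1 + (i + 1) := by ring
        rw [e] at this
        refine ⟨this.1, ?_⟩
        rw [this.2, hcj]
        by_cases h : Even i <;> by_cases h' : Even j <;> simp [h, h', Int.even_add, Int.even_add_one]
  obtain ⟨p, d, h1, h2, h3, hu, hv⟩ := key
  refine ⟨k - 3, d, ?_⟩
  have hinj : ∀ i : ℕ, i ≤ 2 * k - 1 → ∀ i' : ℕ, i' ≤ 2 * k - 1 → p i = p i' → i = i' := by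
    intro i hi i' hi' h
    have h5 := h2 _ _ h
    obtain ⟨t, ht⟩ := h5
    have ha : t < 1 := by
      by_contra hcon
      have : (2 * k : ℤ) * 1 ≤ 2 * k * t := by gcongr; omega
      omega
    have hb : -1 < t := by
      by_contra hcon
      have : (2 * k : ℤ) * t ≤ 2 * k * (-1) := by gcongr; omega
      omega
    have : t = 0 := by omega
    subst this
    omega
  have hvv : p ((2 * k - 1 : ℕ) : ℤ) = v := by
    rw [← hv, ← h1 (-1)]; congr 1; omega
  have e1 : 2 * (k - 3) + 4 + 1 = 2 * k - 1 := by omega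
  have := PathTo.of_fun (φ := φ) (2 * (k - 3) + 4) (H.erase s(u, v)) (fun i : ℕ => p i) d c
    (by rw [e1]; exact hinj) (by
      intro i hi
      have h4 := h3 i
      push_cast
      refine ⟨mem_erase.2 ⟨?_, h4.1⟩, ?_⟩
      · intro h5
        rw [Sym2.eq_iff] at h5
        have hu' : p ((0 : ℕ) : ℤ) = u := by simpa using hu
        have e6 : (i : ℤ) + 1 = ((i + 1 : ℕ) : ℤ) := by push_cast; ring
        rw [e6, ← hu', ← hvv] at h5
        rcases h5 with ⟨h5, h6⟩ | ⟨h5, h6⟩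
        · have := hinj _ (by omega) _ (by omega) h5
          have := hinj _ (by omega) _ (by omega) h6
          omega
        · have := hinj _ (by omega) _ (by omega) h5
          omega
      · rw [h4.2]; simp)
  rw [e1] at this
  simpa [hvv, hu] using this

/-- neighbors through `H` -/
def nb (H : Finset (Sym2 V)) (p : V) : Finset V := univ.filter fun q => s(p, q) ∈ H

lemma nb_card {G : SimpleGraph V} {m : ℕ} (hdeg : ∀ v, (univ.filter fun w => G.Adj v w).card ≤ m + 1)
    {H : Finset (Sym2 V)} (hH : ∀ e ∈ H, e ∈ G.edgeSet) {p w : V} (hw : G.Adj p w)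
    (hwH : s(p, w) ∉ H) : (nb H p).card ≤ m := by
  have h1 : nb H p ⊂ univ.filter fun w => G.Adj p w := by
    rw [Finset.ssubset_iff_of_subset]
    · exact ⟨w, by simpa using hw, by simpa [nb] using hwH⟩
    · intro q hq
      simp only [nb, mem_filter, mem_univ, true_and] at hq ⊢
      exact hH _ hq
  have := card_lt_card h1
  have := hdeg p
  omega

/-- Uncoloring an edge keeps a coloring good. -/
lemma Good.uncolor {G : SimpleGraph V} {φ : PCol V K} (h : Good G φ) (f : Sym2 V) :
    Good G (update φ f none) := by
  have aux : ∀ e x, update φ f none e = some x → φ e = some x := by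
    intro e x he
    by_cases hef : e = f
    · subst hef; simp at he
    · simpa [hef] using he
  refine ⟨fun e he => ?_, fun a b c x h1 h2 => h.proper a b c x (aux _ _ h1) (aux _ _ h2),
    fun a b c d x y h1 h2 h3 h4 => h.four a b c d x y (aux _ _ h1) (aux _ _ h2) (aux _ _ h3)
      (aux _ _ h4)⟩
  obtain ⟨x, hx⟩ := Option.ne_none_iff_exists'.1 he
  exact h.supp e (by rw [aux _ _ hx]; simp)

lemma Good.extend {G : SimpleGraph V} {ψ : PCol V K} (h : Good G ψ) {u v : V} (huv : G.Adj u v)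
    (c : Fin K)
    (hC : ∀ a b, s(a, b) = s(u, v) → ∀ x, ψ s(a, x) ≠ some c)
    (hT : ∀ a b, s(a, b) = s(u, v) → ∀ x y d, ψ s(a, x) = some d → ψ s(b, y) = some d →
      ψ s(x, y) ≠ some c) : Good G (update ψ s(u, v) (some c)) := by
  have supp : ∀ e, update ψ s(u, v) (some c) e ≠ none → e ∈ G.edgeSet := by
    intro e he
    by_cases hef : e = s(u, v)
    · subst hef; exact huv
    · exact h.supp e (by simpa [hef] using he)
  have adj : ∀ a b x, update ψ s(u, v) (some c) s(a, b) = some x → G.Adj a b := by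
    intro a b x hx
    exact supp s(a, b) (by rw [hx]; simp)
  have core : ∀ a b p q x y, s(a, b) = s(u, v) →
      update ψ s(u, v) (some c) s(a, b) = some x → update ψ s(u, v) (some c) s(b, p) = some y →
      update ψ s(u, v) (some c) s(p, q) = some x → update ψ s(u, v) (some c) s(q, a) = some y →
      a = p ∨ b = q := by
    intro a b p q x y hab h1 h2 h3 h4
    have a2 := adj _ _ _ h2
    by_cases e2 : s(b, p) = s(u, v)
    · left
      rw [← hab, Sym2.eq_iff] at e2
      rcases e2 with ⟨e2, e3⟩ | ⟨e2, e3⟩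
      · rw [← e2, e3]
      · exact e3.symm
    by_cases e4 : s(q, a) = s(u, v)
    · right
      rw [← hab, Sym2.eq_iff] at e4
      rcases e4 with ⟨e2, e3⟩ | ⟨e2, e3⟩
      · rw [← e3, e2]
      · exact e2.symm
    by_cases e3 : s(p, q) = s(u, v)
    · left
      rw [← hab, Sym2.eq_iff] at e3
      rcases e3 with ⟨e2, e3⟩ | ⟨e2, e3⟩
      · exact e2.symm
      · subst e2; exact absurd a2 (G.irrefl)
    exfalso
    rw [hab, update_self] at h1
    rw [update_of_ne e2] at h2
    rw [update_of_ne e4] at h4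
    rw [update_of_ne e3] at h3
    rw [← h1] at h3
    rw [Sym2.eq_swap] at h4 h3
    exact hT a b hab q p y h4 h2 h3
  refine ⟨supp, ?_, ?_⟩
  · intro a b p x h1 h2
    by_cases e1 : s(a, b) = s(u, v)
    · by_cases e2 : s(a, p) = s(u, v)
      · rw [← e1] at e2
        exact (Sym2.congr_right.1 e2).symm
      · rw [e1, update_self] at h1
        rw [update_of_ne e2, ← h1] at h2
        exact absurd h2 (hC a b e1 p)
    · by_cases e2 : s(a, p) = s(u, v)
      · rw [e2, update_self] at h2
        rw [update_of_ne e1, ← h2] at h1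
        exact absurd h1 (hC a p e2 b)
      · rw [update_of_ne e1] at h1
        rw [update_of_ne e2] at h2
        exact h.proper a b p x h1 h2
  · intro a b p q x y h1 h2 h3 h4
    by_cases e1 : s(a, b) = s(u, v)
    · exact core a b p q x y e1 h1 h2 h3 h4
    by_cases e2 : s(b, p) = s(u, v)
    · have := core b p q a y x e2 h2 h3 h4 h1
      tauto
    by_cases e3 : s(p, q) = s(u, v)
    · have := core p q a b x y e3 h3 h4 h1 h2
      rcases this with h | h
      · exact Or.inl h.symm
      · exact Or.inr h.symm
    by_cases e4 : s(q, a) = s(u, v)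
    · have := core q a b p y x e4 h4 h1 h2 h3
      rcases this with h | h
      · exact Or.inr h.symm
      · exact Or.inl h
    rw [update_of_ne e1] at h1
    rw [update_of_ne e2] at h2
    rw [update_of_ne e3] at h3
    rw [update_of_ne e4] at h4
    exact h.four a b p q x y h1 h2 h3 h4

lemma colors_card {G : SimpleGraph V} {m : ℕ}
    (hdeg : ∀ v, (univ.filter fun w => G.Adj v w).card ≤ m + 1)
    {ψ : PCol V K} (h : Good G ψ) {u v : V} (huv : G.Adj u v) (hn : ψ s(u, v) = none) :
    (univ.filter fun c : Fin K => ∃ x, ψ s(u, x) = some c).card ≤ m := by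
  have h1 : (univ.filter fun c : Fin K => ∃ x, ψ s(u, x) = some c).card ≤
      ((univ.filter fun w => G.Adj u w).erase v).card := by
    refine card_le_card_of_forall_subsingleton (fun c x => ψ s(u, x) = some c) ?_ ?_
    · intro c hc
      obtain ⟨x, hx⟩ := (mem_filter.1 hc).2
      refine ⟨x, mem_erase.2 ⟨?_, ?_⟩, hx⟩
      · rintro rfl; rw [hn] at hx; simp at hx
      · exact mem_filter.2 ⟨mem_univ _, h.supp s(u, x) (by rw [hx]; simp)⟩
    · intro x _ c hc c' hc'
      have := hc.2.symm.trans hc'.2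
      simpa using this
  rw [card_erase_of_mem (by simpa using huv)] at h1
  have := hdeg u
  omega

lemma ok_card {G : SimpleGraph V} {m : ℕ}
    (hdeg : ∀ v, (univ.filter fun w => G.Adj v w).card ≤ m + 1)
    {ψ : PCol V K} (h : Good G ψ) {u v : V} (huv : G.Adj u v) :
    K ≤ (univ.filter fun c : Fin K => Good G (update ψ s(u, v) (some c))).card + 2 * m := by
  wlog hn : ψ s(u, v) = none generalizing ψ
  · have := this (h.uncolor s(u, v)) (by simp)
    simpa using this
  set A := univ.filter fun c : Fin K => ∃ x, ψ s(u, x) = some c with hA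
  set B := univ.filter fun c : Fin K => ∃ x, ψ s(v, x) = some c with hB
  set T := univ.filter fun c : Fin K => ∃ x y d, ψ s(u, x) = some d ∧ ψ s(v, y) = some d ∧
    ψ s(x, y) = some c with hT
  have cA : A.card ≤ m := colors_card hdeg h huv hn
  have cB : B.card ≤ m := colors_card hdeg h huv.symm (by rw [Sym2.eq_swap]; exact hn)
  have cT : T.card ≤ (A ∩ B).card := by
    refine card_le_card_of_forall_subsingleton
      (fun c d => ∃ x y, ψ s(u, x) = some d ∧ ψ s(v, y) = some d ∧ ψ s(x, y) = some c) ?_ ?_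
    · intro c hc
      obtain ⟨x, y, d, h1, h2, h3⟩ := (mem_filter.1 hc).2
      exact ⟨d, mem_inter.2 ⟨mem_filter.2 ⟨mem_univ _, x, h1⟩, mem_filter.2 ⟨mem_univ _, y, h2⟩⟩,
        x, y, h1, h2, h3⟩
    · rintro d _ c ⟨_, x, y, h1, h2, h3⟩ c' ⟨_, x', y', h1', h2', h3'⟩
      have e1 := h.proper _ _ _ _ h1 h1'
      have e2 := h.proper _ _ _ _ h2 h2'
      subst e1 e2
      simpa using h3.symm.trans h3'
  have hsub : (univ : Finset (Fin K)) ⊆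
      (univ.filter fun c : Fin K => Good G (update ψ s(u, v) (some c))) ∪ ((A ∪ B) ∪ T) := by
    intro c _
    by_contra hcon
    simp only [mem_union, not_or, hA, hB, hT, mem_filter, mem_univ, true_and, not_exists] at hcon
    obtain ⟨h1, ⟨h2, h3⟩, h4⟩ := hcon
    refine h1 (h.extend huv c ?_ ?_)
    · intro a b hab x
      rw [Sym2.eq_iff] at hab
      rcases hab with ⟨rfl, rfl⟩ | ⟨rfl, rfl⟩
      · exact h2 x
      · exact h3 x
    · intro a b hab x y d k1 k2 k3
      rw [Sym2.eq_iff] at hab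
      rcases hab with ⟨rfl, rfl⟩ | ⟨rfl, rfl⟩
      · exact h4 x y d ⟨k1, k2, k3⟩
      · rw [Sym2.eq_swap] at k3
        exact h4 y x d ⟨k2, k1, k3⟩
  have e1 := card_le_card hsub
  rw [card_univ, Fintype.card_fin] at e1
  have e2 := card_union_le
    (univ.filter fun c : Fin K => Good G (update ψ s(u, v) (some c))) ((A ∪ B) ∪ T)
  have e3 := card_union_le (A ∪ B) T
  have e4 := card_union_add_card_inter A B
  omega

/-- The real number of colorings in the class. -/
def N (G : SimpleGraph V) (H : Finset (Sym2 V)) (π : PCol V K) : ℝ := ((Cls G H π).card : ℝ)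

lemma N_nonneg (G : SimpleGraph V) (H : Finset (Sym2 V)) (π : PCol V K) : 0 ≤ N G H π :=
  Nat.cast_nonneg _

/-- Coloring `uv` with `c` would close a long bichromatic cycle. -/
def Bad (φ : PCol V K) (v : V) (H : Finset (Sym2 V)) (u : V) (c : Fin K) : Prop :=
  ∃ (l : ℕ) (d : Fin K), PathTo φ v (2 * l + 4) H u d c

lemma Bad.congr {φ φ' : PCol V K} {v u : V} {H : Finset (Sym2 V)} {c : Fin K}
    (h : ∀ e ∈ H, φ' e = φ e) (hb : Bad φ v H u c) : Bad φ' v H u c := by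
  obtain ⟨l, d, hp⟩ := hb
  exact ⟨l, d, hp.congr h⟩

/-- Numerical parameters of the counting argument. -/
structure Par (m K : ℕ) (β ρ g lam z : ℝ) : Prop where
  hm : 1 ≤ m
  hβ : 0 < β
  hρ : 0 < ρ
  hρ1 : ρ < 1
  hg : 0 ≤ g
  hz0 : 0 ≤ z
  hz : z ≤ 1
  hlam : 1 + g / β ≤ lam
  hgg : lam ^ 2 * ρ ^ 2 ≤ g * (β * (1 - ρ ^ 2))
  hzz : lam * ρ ^ 3 ≤ z * (β * (1 - ρ ^ 2))
  hK : (β + g) * m + 2 * m ≤ K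
  hD : (m : ℝ) ≤ ρ * (β * m + (m - 1) * (1 - z))

/-- The induction hypothesis. -/
def BB (G : SimpleGraph V) (K m : ℕ) (g z : ℝ) (n : ℕ) : Prop :=
  ∀ H : Finset (Sym2 V), H.card < n → (∀ e ∈ H, e ∈ G.edgeSet) → ∀ (π : PCol V K) (u v : V),
    G.Adj u v → s(u, v) ∉ H →
    (∑ c : Fin K, (((Cls G H π).filter fun φ => Bad φ v H u c).card : ℝ) ≤ g * m * N G H π) ∧
    ∀ x, (((Cls G H π).filter fun φ => Bad φ v H u x).card : ℝ) ≤ z * N G H π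

section
variable {G : SimpleGraph V} {m : ℕ} {β ρ g lam z : ℝ} {n : ℕ}

lemma ext_mem {H : Finset (Sym2 V)} {u v : V} (hf : s(u, v) ∈ H) {π : PCol V K}
    {o : Option (Fin K)} {ψ : PCol V K}
    (hψ : ψ ∈ Cls G (H.erase s(u, v)) (update π s(u, v) o)) {c : Fin K}
    (hgood : Good G (update ψ s(u, v) (some c)))
    (hbad : ¬ Bad ψ v (H.erase s(u, v)) u c) :
    update ψ s(u, v) (some c) ∈ Cls G H π := by
  rw [mem_Cls] at hψ ⊢
  obtain ⟨h1, h2, h3, h4⟩ := hψ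
  have hag : ∀ e ∈ H.erase s(u, v), update ψ s(u, v) (some c) e = ψ e := by
    intro e he
    rw [update_of_ne (mem_erase.1 he).1]
  refine ⟨?_, ?_, hgood, ?_⟩
  · intro e he
    have hne : e ≠ s(u, v) := by rintro rfl; exact he hf
    rw [update_of_ne hne, h1 e (fun h => he (mem_of_mem_erase h)), update_of_ne hne]
  · intro e he
    by_cases hne : e = s(u, v)
    · rw [hne, update_self]; simp
    · rw [update_of_ne hne]; exact h2 e (mem_erase.2 ⟨hne, he⟩)
  · intro hl
    have hn : ¬ HasLong (H.erase s(u, v)) (update ψ s(u, v) (some c)) := fun h =>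
      h4 (h.mono (Subset.refl _) (fun e he => (hag e he).symm))
    have := hl.trail hn (c := c) (by simp)
    exact hbad (Bad.congr (fun e he => (hag e he).symm) this)

lemma Ext (P : Par m K β ρ g lam z)
    (hdeg : ∀ v, (univ.filter fun w => G.Adj v w).card ≤ m + 1)
    (hBB : BB G K m g z n) {H : Finset (Sym2 V)} (hn : H.card ≤ n)
    (hH : ∀ e ∈ H, e ∈ G.edgeSet) {u v : V} (hf : s(u, v) ∈ H) (π : PCol V K)
    (o : Option (Fin K)) :
    β * m * N G (H.erase s(u, v)) (update π s(u, v) o) ≤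
      (((Cls G H π).filter fun φ => update φ s(u, v) o ∈
        Cls G (H.erase s(u, v)) (update π s(u, v) o)).card : ℝ) := by
  have huv : G.Adj u v := hH _ hf
  set H' := H.erase s(u, v) with hH'
  set π' := update π s(u, v) o with hπ'
  have hfH' : s(u, v) ∉ H' := by simp [hH']
  have hcard : H'.card < n := by
    rw [hH']
    have := card_erase_lt_of_mem hf
    omega
  have hB := (hBB H' hcard (fun e he => hH e (mem_of_mem_erase he)) π' u v huv hfH').1
  set ok : PCol V K → Finset (Fin K) := fun ψ =>
    univ.filter fun c : Fin K => Good G (update ψ s(u, v) (some c)) ∧ ¬ Bad ψ v H' u c with hok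
  have h1 : ∀ ψ ∈ Cls G H' π', (K : ℝ) - 2 * m ≤
      ((ok ψ).card : ℝ) + ∑ c : Fin K, if Bad ψ v H' u c then (1 : ℝ) else 0 := by
    intro ψ hψ
    have e1 := ok_card hdeg (mem_Cls.1 hψ).2.2.1 huv
    have e2 : (univ.filter fun c : Fin K => Good G (update ψ s(u, v) (some c))) ⊆
        ok ψ ∪ univ.filter fun c => Bad ψ v H' u c := by
      intro c hc
      simp only [hok, mem_union, mem_filter, mem_univ, true_and] at hc ⊢
      tauto
    have e3 := (card_le_card e2).trans (card_union_le _ _)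
    rw [sum_boole]
    have e4 : (K : ℝ) ≤ ((ok ψ).card + (univ.filter fun c => Bad ψ v H' u c).card + 2 * m : ℕ) := by
      exact_mod_cast e1.trans (by omega)
    push_cast at e4
    linarith
  have h2 := sum_le_sum h1
  rw [sum_const, nsmul_eq_mul, sum_add_distrib, sum_comm] at h2
  simp only [sum_boole] at h2
  have h3 : ∑ ψ ∈ Cls G H' π', (ok ψ).card ≤ ((Cls G H π).filter fun φ => update φ s(u, v) o ∈
        Cls G H' π').card := by
    rw [card_eq_sum_card_fiberwise (f := fun φ : PCol V K => update φ s(u, v) o)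
      (s := (Cls G H π).filter fun φ => update φ s(u, v) o ∈ Cls G H' π')
      (t := Cls G H' π') (fun φ hφ => (mem_filter.1 hφ).2)]
    refine sum_le_sum fun ψ hψ => ?_
    refine card_le_card_of_injOn (fun c => update ψ s(u, v) (some c)) ?_ ?_
    · intro c hc
      simp only [hok, coe_filter, mem_univ, true_and, Set.mem_ofPred_eq] at hc
      have e1 : update (update ψ s(u, v) (some c)) s(u, v) o = ψ := by
        have : ψ s(u, v) = o := by
          rw [(mem_Cls.1 hψ).1 _ hfH', hπ', update_self]
        rw [update_idem, ← this, update_eq_self]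
      simp only [coe_filter, mem_filter, Set.mem_ofPred_eq, e1, and_true]
      exact ⟨ext_mem hf hψ hc.1 hc.2, hψ⟩
    · intro c _ c' _ h
      have := congrFun h s(u, v)
      simpa using this
  have h4 : ((∑ ψ ∈ Cls G H' π', (ok ψ).card : ℕ) : ℝ) ≤ _ := Nat.cast_le.2 h3
  push_cast at h4
  have hK := P.hK
  have hN := N_nonneg G H' π'
  have h5 : ((β + g) * m) * N G H' π' ≤ N G H' π' * (K - 2 * m) := by
    rw [mul_comm]
    exact mul_le_mul_of_nonneg_left (by linarith) hN
  unfold N at *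
  linarith

lemma A_bound (P : Par m K β ρ g lam z)
    (hdeg : ∀ v, (univ.filter fun w => G.Adj v w).card ≤ m + 1)
    (hBB : BB G K m g z n) {H : Finset (Sym2 V)} (hn : H.card ≤ n)
    (hH : ∀ e ∈ H, e ∈ G.edgeSet) {u v : V} (hf : s(u, v) ∈ H) (π : PCol V K)
    (o : Option (Fin K)) :
    β * m * N G (H.erase s(u, v)) (update π s(u, v) o) ≤ N G H π :=
  (Ext P hdeg hBB hn hH hf π o).trans (Nat.cast_le.2 (card_le_card (filter_subset _ _)))

lemma sub1 {H : Finset (Sym2 V)} {f : Sym2 V} {π φ : PCol V K} {x : Fin K}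
    (h : φ ∈ Cls G H π) (hx : φ f = some x) : φ ∈ Cls G (H.erase f) (update π f (some x)) := by
  rw [mem_Cls] at h ⊢
  obtain ⟨h1, h2, h3, h4⟩ := h
  refine ⟨?_, fun e he => h2 e (mem_of_mem_erase he), h3,
    fun hl => h4 (hl.mono (erase_subset _ _) fun _ _ => rfl)⟩
  intro e he
  by_cases hef : e = f
  · rw [hef, update_self, hx]
  · rw [update_of_ne hef]
    exact h1 e fun h => he (mem_erase.2 ⟨hef, h⟩)

lemma uncolor_mem {H : Finset (Sym2 V)} {f : Sym2 V} {π φ : PCol V K} {o : Option (Fin K)}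
    (hf : f ∉ H) (h : φ ∈ Cls G H (update π f o)) :
    update φ f none ∈ Cls G H (update π f none) := by
  rw [mem_Cls] at h ⊢
  obtain ⟨h1, h2, h3, h4⟩ := h
  have hne : ∀ e ∈ H, e ≠ f := by rintro e he rfl; exact hf he
  refine ⟨?_, ?_, h3.uncolor f, ?_⟩
  · intro e he
    by_cases hef : e = f
    · simp [hef]
    · rw [update_of_ne hef, update_of_ne hef, h1 e he, update_of_ne hef]
  · intro e he
    rw [update_of_ne (hne e he)]; exact h2 e he
  · intro hl
    exact h4 (hl.mono (Subset.refl _) fun e he => by rw [update_of_ne (hne e he)])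

lemma uncolor_inj {H : Finset (Sym2 V)} {f : Sym2 V} {π φ φ' : PCol V K} {o : Option (Fin K)}
    (hf : f ∉ H) (h : φ ∈ Cls G H (update π f o)) (h' : φ' ∈ Cls G H (update π f o))
    (he : update φ f none = update φ' f none) : φ = φ' := by
  have e1 := (mem_Cls.1 h).1 f hf
  have e2 := (mem_Cls.1 h').1 f hf
  funext e
  by_cases hef : e = f
  · rw [hef, e1, e2]
  · have := congrFun he e
    rwa [update_of_ne hef, update_of_ne hef] at this

lemma restr {H : Finset (Sym2 V)} {f : Sym2 V} (hf : f ∉ H) (π : PCol V K) (o : Option (Fin K)) :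
    N G H (update π f o) ≤ N G H (update π f none) := by
  refine Nat.cast_le.2 (card_le_card_of_injOn (fun φ => update φ f none) ?_ ?_)
  · intro φ hφ; exact uncolor_mem hf hφ
  · intro φ h φ' h' he; exact uncolor_inj hf h h' he

lemma restr_bad {H : Finset (Sym2 V)} {u v : V} (hf : s(u, v) ∉ H) (π : PCol V K)
    (o : Option (Fin K)) (d : Fin K) :
    ((Cls G H (update π s(u, v) o)).filter fun φ => Bad φ v H u d).card ≤
      ((Cls G H (update π s(u, v) none)).filter fun φ => Bad φ v H u d).card := by
  refine card_le_card_of_injOn (fun φ => update φ s(u, v) none) ?_ ?_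
  · intro φ hφ
    rw [mem_coe, mem_filter] at hφ
    simp only [coe_filter, Set.mem_ofPred_eq]
    refine ⟨uncolor_mem hf hφ.1, hφ.2.congr ?_⟩
    intro e he
    rw [update_of_ne]
    rintro rfl; exact hf he
  · intro φ h φ' h' he
    rw [mem_coe, mem_filter] at h h'
    exact uncolor_inj hf h.1 h'.1 he

lemma split {H : Finset (Sym2 V)} {u v : V} (hf : s(u, v) ∈ H) (π : PCol V K) (d : Fin K) :
    N G (H.erase s(u, v)) (update π s(u, v) (some d)) ≤
      (((Cls G H π).filter fun φ => φ s(u, v) = some d).card : ℝ) +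
      (((Cls G (H.erase s(u, v)) (update π s(u, v) (some d))).filter fun φ =>
        Bad φ v (H.erase s(u, v)) u d).card : ℝ) := by
  unfold N
  have : Cls G (H.erase s(u, v)) (update π s(u, v) (some d)) ⊆
      ((Cls G H π).filter fun φ => φ s(u, v) = some d) ∪
      ((Cls G (H.erase s(u, v)) (update π s(u, v) (some d))).filter fun φ =>
        Bad φ v (H.erase s(u, v)) u d) := by
    intro φ hφ
    have e1 : φ s(u, v) = some d := by
      rw [(mem_Cls.1 hφ).1 _ (by simp), update_self]
    have e2 : update φ s(u, v) (some d) = φ := by rw [← e1, update_eq_self]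
    by_cases hb : Bad φ v (H.erase s(u, v)) u d
    · exact mem_union_right _ (mem_filter.2 ⟨hφ, hb⟩)
    · refine mem_union_left _ (mem_filter.2 ⟨?_, e1⟩)
      have := ext_mem hf hφ (c := d) (by rw [e2]; exact (mem_Cls.1 hφ).2.2.1) hb
      rwa [e2] at this
  exact_mod_cast (card_le_card this).trans (card_union_le _ _)

lemma L_bound (P : Par m K β ρ g lam z)
    (hdeg : ∀ v, (univ.filter fun w => G.Adj v w).card ≤ m + 1)
    (hBB : BB G K m g z n) {H : Finset (Sym2 V)} (hn : H.card ≤ n)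
    (hH : ∀ e ∈ H, e ∈ G.edgeSet) {u v : V} (hf : s(u, v) ∈ H) (π : PCol V K) :
    ∑ d : Fin K, N G (H.erase s(u, v)) (update π s(u, v) (some d)) ≤ lam * N G H π := by
  have hfH' : s(u, v) ∉ H.erase s(u, v) := by simp
  have hcard : (H.erase s(u, v)).card < n := by
    have := card_erase_lt_of_mem hf
    omega
  have hB := (hBB (H.erase s(u, v)) hcard (fun e he => hH e (mem_of_mem_erase he))
    (update π s(u, v) none) u v (hH _ hf) hfH').1
  have h1 : ∑ d : Fin K, (((Cls G H π).filter fun φ => φ s(u, v) = some d).card : ℝ) ≤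
      N G H π := by
    unfold N
    rw [← Nat.cast_sum, ← card_biUnion]
    · refine Nat.cast_le.2 (card_le_card ?_)
      intro φ hφ
      rw [mem_biUnion] at hφ
      obtain ⟨d, _, hd⟩ := hφ
      exact (mem_filter.1 hd).1
    · intro d _ d' _ hdd
      rw [Function.onFun, Finset.disjoint_left]
      intro φ h1 h2
      have := (mem_filter.1 h1).2.symm.trans (mem_filter.1 h2).2
      exact hdd (by simpa using this)
  have h2 : ∑ d : Fin K, N G (H.erase s(u, v)) (update π s(u, v) (some d)) ≤
      N G H π + g * m * N G (H.erase s(u, v)) (update π s(u, v) none) := by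
    refine (sum_le_sum fun d _ => split hf π d).trans ?_
    rw [sum_add_distrib]
    refine add_le_add h1 (le_trans (sum_le_sum fun d _ => ?_) hB)
    exact Nat.cast_le.2 (restr_bad hfH' π (some d) d)
  have h3 := A_bound P hdeg hBB hn hH hf π none
  have hβ := P.hβ
  have h4 : g * m * N G (H.erase s(u, v)) (update π s(u, v) none) ≤ g / β * N G H π := by
    have := mul_le_mul_of_nonneg_left h3 (div_nonneg P.hg hβ.le)
    refine le_trans (le_of_eq ?_) this
    field_simp
  have h5 := mul_le_mul_of_nonneg_right P.hlam (N_nonneg G H π)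
  linarith

lemma D_bound (P : Par m K β ρ g lam z)
    (hdeg : ∀ v, (univ.filter fun w => G.Adj v w).card ≤ m + 1)
    (hBB : BB G K m g z n) {H : Finset (Sym2 V)} (hn : H.card ≤ n)
    (hH : ∀ e ∈ H, e ∈ G.edgeSet) {p w : V} (hw : G.Adj p w) (hwH : s(p, w) ∉ H)
    (π : PCol V K) (x : Fin K) :
    ∑ q ∈ nb H p, N G (H.erase s(p, q)) (update π s(p, q) (some x)) ≤ ρ * N G H π := by
  have hcardm := nb_card hdeg hH hw hwH
  set Q := nb H p with hQ
  have hmem : ∀ q, q ∈ Q ↔ s(p, q) ∈ H := by intro q; simp [hQ, nb]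
  set Y : V → ℝ := fun q => N G (H.erase s(p, q)) (update π s(p, q) (some x)) with hY
  set X : V → Finset (PCol V K) := fun q => (Cls G H π).filter fun φ => φ s(p, q) = some x with hX
  set X0 : Finset (PCol V K) := (Cls G H π).filter fun φ => ∀ q ∈ Q, φ s(p, q) ≠ some x with hX0
  have hdisj : (Q : Set V).PairwiseDisjoint X := by
    intro q _ q' _ hqq
    rw [Function.onFun, Finset.disjoint_left]
    intro φ h1 h2
    have h1 := mem_filter.1 h1
    have h2 := mem_filter.1 h2
    exact hqq ((mem_Cls.1 h1.1).2.2.1.proper _ _ _ _ h1.2 h2.2)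
  have htot : (X0.card : ℝ) + ∑ q ∈ Q, ((X q).card : ℝ) ≤ N G H π := by
    unfold N
    rw [← Nat.cast_sum, ← card_biUnion hdisj, ← Nat.cast_add, ← card_union_of_disjoint]
    · refine Nat.cast_le.2 (card_le_card ?_)
      refine union_subset (filter_subset _ _) ?_
      intro φ hφ
      rw [mem_biUnion] at hφ
      obtain ⟨d, _, hd⟩ := hφ
      exact (mem_filter.1 hd).1
    · rw [Finset.disjoint_left]
      intro φ h1 h2
      rw [mem_biUnion] at h2
      obtain ⟨q, hq, hd⟩ := h2
      exact (mem_filter.1 h1).2 q hq (mem_filter.1 hd).2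
  have hcard : ∀ q ∈ Q, (H.erase s(p, q)).card < n := by
    intro q hq
    have := card_erase_lt_of_mem ((hmem q).1 hq)
    omega
  have h1 : ∀ q ∈ Q, β * m * Y q ≤ X0.card + (X q).card := by
    intro q hq
    refine (Ext P hdeg hBB hn hH ((hmem q).1 hq) π (some x)).trans ?_
    rw [← Nat.cast_add]
    refine Nat.cast_le.2 (le_trans (card_le_card ?_) (card_union_le _ _))
    intro φ hφ
    obtain ⟨e1, e2⟩ := mem_filter.1 hφ
    rw [mem_union]
    by_cases hx : φ s(p, q) = some x
    · exact Or.inr (mem_filter.2 ⟨e1, hx⟩)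
    · refine Or.inl (mem_filter.2 ⟨e1, ?_⟩)
      intro q' hq' hx'
      have hne : s(p, q') ≠ s(p, q) := by
        intro h
        rw [h] at hx'
        exact hx hx'
      have := (mem_Cls.1 e2).2.2.1.proper p q q' x (by simp) (by rw [update_of_ne hne]; exact hx')
      exact hne (by rw [this])
  have h2 : ∀ q ∈ Q, (1 - z) * Y q ≤ (X q).card := by
    intro q hq
    have e1 := split (G := G) ((hmem q).1 hq) π x
    have e2 := (hBB (H.erase s(p, q)) (hcard q hq) (fun e he => hH e (mem_of_mem_erase he))
      (update π s(p, q) (some x)) p q (hH _ ((hmem q).1 hq)) (by simp)).2 x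
    have : Y q ≤ (X q).card + z * Y q := e1.trans (add_le_add le_rfl e2)
    linarith
  set S := ∑ q ∈ Q, Y q with hS
  have h3 : ∀ q ∈ Q, β * m * Y q + (1 - z) * (S - Y q) ≤ N G H π := by
    intro q hq
    have e1 : ∑ q' ∈ Q.erase q, (1 - z) * Y q' ≤ ∑ q' ∈ Q.erase q, ((X q').card : ℝ) :=
      sum_le_sum fun q' hq' => h2 q' (mem_of_mem_erase hq')
    have e2 := add_sum_erase Q Y hq
    have e3 := add_sum_erase Q (fun q => ((X q).card : ℝ)) hq
    rw [← mul_sum] at e1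
    have e4 : ∑ q' ∈ Q.erase q, Y q' = S - Y q := by rw [hS]; linarith
    rw [e4] at e1
    have := h1 q hq
    linarith
  have h4 := sum_le_sum h3
  rw [sum_add_distrib, ← mul_sum, ← mul_sum, sum_sub_distrib, sum_const, sum_const, nsmul_eq_mul,
    nsmul_eq_mul, ← hS] at h4
  have hN := N_nonneg G H π
  have hm1 : (1 : ℝ) ≤ m := by exact_mod_cast P.hm
  rcases Nat.eq_zero_or_pos Q.card with h0 | hpos
  · have : S = 0 := by rw [hS, card_eq_zero.1 h0, sum_empty]
    rw [this]
    exact mul_nonneg P.hρ.le hN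
  have hq1 : (1 : ℝ) ≤ Q.card := by exact_mod_cast hpos
  have hqm : (Q.card : ℝ) ≤ m := by exact_mod_cast hcardm
  set t : ℝ := (Q.card : ℝ) with ht
  have hpos2 : 0 < β * m + (t - 1) * (1 - z) := by
    have := mul_pos P.hβ (by linarith : (0 : ℝ) < m)
    have := mul_nonneg (by linarith : 0 ≤ t - 1) (by linarith [P.hz] : 0 ≤ 1 - z)
    linarith
  have hD : t ≤ ρ * (β * m + (t - 1) * (1 - z)) := by
    have h5 := P.hD
    have hz0 : ρ * (1 - z) ≤ 1 := by
      nlinarith [P.hz0, P.hz, P.hρ, P.hρ1]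
    nlinarith
  have h7 : (β * m + (t - 1) * (1 - z)) * S ≤ (β * m + (t - 1) * (1 - z)) * (ρ * N G H π) := by
    have := mul_le_mul_of_nonneg_right hD hN
    linarith
  exact le_of_mul_le_mul_left h7 hpos2

end
section
variable {G : SimpleGraph V} {m : ℕ} {β ρ g lam z : ℝ} {n : ℕ}

/-- Number of colorings in the class with a prescribed trail. -/
def T (G : SimpleGraph V) (v : V) (j : ℕ) (H : Finset (Sym2 V)) (π : PCol V K) (p : V)
    (x y : Fin K) : ℝ := (((Cls G H π).filter fun φ => PathTo φ v j H p x y).card : ℝ)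

lemma T_step (v : V) (j : ℕ) (H : Finset (Sym2 V)) (π : PCol V K) (p : V) (x y : Fin K) :
    T G v (j + 1) H π p x y ≤
      ∑ q ∈ nb H p, T G v j (H.erase s(p, q)) (update π s(p, q) (some x)) q y x := by
  unfold T
  rw [← Nat.cast_sum]
  refine Nat.cast_le.2 (le_trans (card_le_card ?_) card_biUnion_le)
  intro φ hφ
  obtain ⟨h1, q, h2, h3, h4⟩ := mem_filter.1 hφ
  exact mem_biUnion.2 ⟨q, by simpa [nb] using h2, mem_filter.2 ⟨sub1 h1 h3, h4⟩⟩

lemma Par.b_pos (P : Par m K β ρ g lam z) : 0 < β * m :=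
  mul_pos P.hβ (by exact_mod_cast P.hm)

lemma Par.lam_pos (P : Par m K β ρ g lam z) : 0 < lam := by
  have := P.hlam
  have := div_nonneg P.hg P.hβ.le
  linarith

lemma mem_nb {H : Finset (Sym2 V)} {p q : V} : q ∈ nb H p ↔ s(p, q) ∈ H := by simp [nb]

lemma C_bound (P : Par m K β ρ g lam z)
    (hdeg : ∀ v, (univ.filter fun w => G.Adj v w).card ≤ m + 1)
    (hBB : BB G K m g z n) (v : V) : ∀ (j : ℕ) (H : Finset (Sym2 V)), H.card ≤ n →
    (∀ e ∈ H, e ∈ G.edgeSet) → ∀ (p w : V), G.Adj p w → s(p, w) ∉ H →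
    ∀ (π : PCol V K) (x y : Fin K), T G v j H π p x y ≤ ρ ^ j / (β * m) * N G H π
  | 0, H, hn, hH, p, w, hw, hwH, π, x, y => by
      have hb := P.b_pos
      by_cases hf : s(p, v) ∈ H
      · have h1 : T G v 0 H π p x y ≤ N G (H.erase s(p, v)) (update π s(p, v) (some x)) := by
          refine Nat.cast_le.2 (card_le_card ?_)
          intro φ hφ
          obtain ⟨h1, h2⟩ := mem_filter.1 hφ
          exact sub1 h1 h2.2
        have h2 := A_bound P hdeg hBB hn hH hf π (some x)
        refine h1.trans ?_
        rw [pow_zero, one_div, ← div_eq_inv_mul, le_div_iff₀ hb, mul_comm]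
        exact h2
      · have h1 : T G v 0 H π p x y = 0 := by
          unfold T
          rw [Nat.cast_eq_zero, card_eq_zero, filter_eq_empty_iff]
          intro φ _ h
          exact hf h.1
        rw [h1]
        exact mul_nonneg (div_nonneg (pow_nonneg P.hρ.le _) hb.le) (N_nonneg _ _ _)
  | j + 1, H, hn, hH, p, w, hw, hwH, π, x, y => by
      have hb := P.b_pos
      refine (T_step v j H π p x y).trans ?_
      have h1 : ∀ q ∈ nb H p, T G v j (H.erase s(p, q)) (update π s(p, q) (some x)) q y x ≤
          ρ ^ j / (β * m) * N G (H.erase s(p, q)) (update π s(p, q) (some x)) := by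
        intro q hq
        have hq := mem_nb.1 hq
        refine C_bound P hdeg hBB v j _ ((card_le_card (erase_subset _ _)).trans hn)
          (fun e he => hH e (mem_of_mem_erase he)) q p (G.adj_symm (hH _ hq)) ?_ _ _ _
        rw [Sym2.eq_swap]; simp
      refine (sum_le_sum h1).trans ?_
      rw [← mul_sum]
      have h2 := D_bound P hdeg hBB hn hH hw hwH π x
      refine (mul_le_mul_of_nonneg_left h2 (div_nonneg (pow_nonneg P.hρ.le _) hb.le)).trans ?_
      apply le_of_eq
      ring

lemma P1_bound (P : Par m K β ρ g lam z)
    (hdeg : ∀ v, (univ.filter fun w => G.Adj v w).card ≤ m + 1)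
    (hBB : BB G K m g z n) (v : V) (j : ℕ) {H : Finset (Sym2 V)} (hn : H.card ≤ n)
    (hH : ∀ e ∈ H, e ∈ G.edgeSet) {p w : V} (hw : G.Adj p w) (hwH : s(p, w) ∉ H)
    (π : PCol V K) (y : Fin K) :
    ∑ x, T G v (j + 1) H π p x y ≤ m * lam * (ρ ^ j / (β * m)) * N G H π := by
  have hb := P.b_pos
  have hnn : 0 ≤ ρ ^ j / (β * m) := div_nonneg (pow_nonneg P.hρ.le _) hb.le
  refine (sum_le_sum fun x _ => T_step v j H π p x y).trans ?_
  rw [sum_comm]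
  have h1 : ∀ q ∈ nb H p, ∑ x, T G v j (H.erase s(p, q)) (update π s(p, q) (some x)) q y x ≤
      ρ ^ j / (β * m) * (lam * N G H π) := by
    intro q hq
    have hq := mem_nb.1 hq
    refine le_trans ?_ (mul_le_mul_of_nonneg_left (L_bound P hdeg hBB hn hH hq π) hnn)
    rw [mul_sum]
    refine sum_le_sum fun x _ => ?_
    · refine C_bound P hdeg hBB v j _ ((card_le_card (erase_subset _ _)).trans hn)
        (fun e he => hH e (mem_of_mem_erase he)) q p (G.adj_symm (hH _ hq)) ?_ _ _ _
      rw [Sym2.eq_swap]; simp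
  refine (sum_le_sum h1).trans ?_
  rw [sum_const, nsmul_eq_mul]
  have h2 : ((nb H p).card : ℝ) ≤ m := by exact_mod_cast nb_card hdeg hH hw hwH
  refine (mul_le_mul_of_nonneg_right h2
    (mul_nonneg hnn (mul_nonneg P.lam_pos.le (N_nonneg _ _ _)))).trans ?_
  apply le_of_eq
  ring

lemma P2_bound (P : Par m K β ρ g lam z)
    (hdeg : ∀ v, (univ.filter fun w => G.Adj v w).card ≤ m + 1)
    (hBB : BB G K m g z n) (v : V) (j : ℕ) {H : Finset (Sym2 V)} (hn : H.card ≤ n)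
    (hH : ∀ e ∈ H, e ∈ G.edgeSet) {p w : V} (hw : G.Adj p w) (hwH : s(p, w) ∉ H)
    (π : PCol V K) :
    ∑ y, ∑ x, T G v (j + 2) H π p x y ≤ m ^ 2 * lam ^ 2 * (ρ ^ j / (β * m)) * N G H π := by
  have hb := P.b_pos
  have hlam := P.lam_pos
  have hnn : 0 ≤ ρ ^ j / (β * m) := div_nonneg (pow_nonneg P.hρ.le _) hb.le
  have hnn2 : 0 ≤ m * lam * (ρ ^ j / (β * m)) :=
    mul_nonneg (mul_nonneg (Nat.cast_nonneg _) hlam.le) hnn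
  refine (sum_le_sum fun y _ => sum_le_sum fun x _ => T_step v (j + 1) H π p x y).trans ?_
  rw [sum_comm]
  have e : ∀ x : Fin K, ∑ y : Fin K, ∑ q ∈ nb H p,
      T G v (j + 1) (H.erase s(p, q)) (update π s(p, q) (some x)) q y x =
      ∑ q ∈ nb H p, ∑ y : Fin K,
        T G v (j + 1) (H.erase s(p, q)) (update π s(p, q) (some x)) q y x :=
    fun x => sum_comm
  rw [sum_congr rfl fun x _ => e x, sum_comm]
  have h1 : ∀ q ∈ nb H p, ∑ x, ∑ y,
      T G v (j + 1) (H.erase s(p, q)) (update π s(p, q) (some x)) q y x ≤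
      m * lam * (ρ ^ j / (β * m)) * (lam * N G H π) := by
    intro q hq
    have hq := mem_nb.1 hq
    refine le_trans ?_ (mul_le_mul_of_nonneg_left (L_bound P hdeg hBB hn hH hq π) hnn2)
    rw [mul_sum]
    refine sum_le_sum fun x _ => ?_
    · refine P1_bound P hdeg hBB v j ((card_le_card (erase_subset _ _)).trans hn)
        (fun e he => hH e (mem_of_mem_erase he)) (w := p) (G.adj_symm (hH _ hq)) ?_ _ _
      rw [Sym2.eq_swap]; simp
  refine (sum_le_sum h1).trans ?_
  rw [sum_const, nsmul_eq_mul]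
  have h2 : ((nb H p).card : ℝ) ≤ m := by exact_mod_cast nb_card hdeg hH hw hwH
  refine (mul_le_mul_of_nonneg_right h2
    (mul_nonneg hnn2 (mul_nonneg P.lam_pos.le (N_nonneg _ _ _)))).trans ?_
  apply le_of_eq
  ring

lemma geom (hρ : 0 < ρ) (hρ1 : ρ < 1) (k : ℕ) :
    ∑ l ∈ range k, ρ ^ (2 * l) ≤ 1 / (1 - ρ ^ 2) := by
  have h1 : ρ ^ 2 < 1 := by nlinarith
  have := (summable_geometric_of_lt_one (by positivity) h1).sum_le_tsum (range k)
    (fun i _ => by positivity)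
  rw [tsum_geometric_of_lt_one (by positivity) h1] at this
  simpa [pow_mul] using this

lemma bad_le (H : Finset (Sym2 V)) (π : PCol V K) (u v : V) (c : Fin K) :
    (((Cls G H π).filter fun φ => Bad φ v H u c).card : ℝ) ≤
      ∑ l ∈ range H.card, ∑ d, T G v (2 * l + 4) H π u d c := by
  unfold T
  simp only [← Nat.cast_sum]
  refine Nat.cast_le.2 ?_
  calc _ ≤ ((range H.card).biUnion fun l => univ.biUnion fun d =>
        (Cls G H π).filter fun φ => PathTo φ v (2 * l + 4) H u d c).card := by
        refine card_le_card ?_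
        intro φ hφ
        obtain ⟨h1, l, d, h2⟩ := mem_filter.1 hφ
        refine mem_biUnion.2 ⟨l, ?_, mem_biUnion.2 ⟨d, mem_univ _, mem_filter.2 ⟨h1, h2⟩⟩⟩
        have := h2.card
        rw [mem_range]
        omega
    _ ≤ _ := card_biUnion_le.trans (sum_le_sum fun l _ => card_biUnion_le)

lemma BB_all (P : Par m K β ρ g lam z)
    (hdeg : ∀ v, (univ.filter fun w => G.Adj v w).card ≤ m + 1) : ∀ n, BB G K m g z n
  | 0 => fun H h => absurd h (by omega)
  | n + 1 => by
      have hBB := BB_all P hdeg n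
      intro H hn hH π u v huv hf
      have hn : H.card ≤ n := by omega
      have hN := N_nonneg G H π
      have hm : (0 : ℝ) < m := by exact_mod_cast P.hm
      have hβ := P.hβ
      have hlam := P.lam_pos
      have hρ := P.hρ
      have hge := geom P.hρ P.hρ1 H.card
      have h1 : 0 < 1 - ρ ^ 2 := by nlinarith [P.hρ1]
      constructor
      · refine (sum_le_sum fun c _ => bad_le H π u v c).trans ?_
        rw [sum_comm]
        refine (sum_le_sum fun l _ =>
          P2_bound P hdeg hBB v (2 * l + 2) hn hH huv hf π).trans ?_
        have e : ∀ l : ℕ, (m : ℝ) ^ 2 * lam ^ 2 * (ρ ^ (2 * l + 2) / (β * m)) * N G H π =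
            (m * lam ^ 2 * ρ ^ 2 / β * N G H π) * ρ ^ (2 * l) := by
          intro l; field_simp; ring
        simp only [e]
        rw [← mul_sum]
        refine (mul_le_mul_of_nonneg_left hge (by positivity)).trans ?_
        have e2 : m * lam ^ 2 * ρ ^ 2 / β * N G H π * (1 / (1 - ρ ^ 2)) =
          (lam ^ 2 * ρ ^ 2 / (β * (1 - ρ ^ 2))) * m * N G H π := by field_simp
        rw [e2]
        have : lam ^ 2 * ρ ^ 2 / (β * (1 - ρ ^ 2)) ≤ g := by
          rw [div_le_iff₀ (by positivity)]; exact P.hgg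
        gcongr
      · intro x
        refine (bad_le H π u v x).trans ?_
        refine (sum_le_sum fun l _ =>
          P1_bound P hdeg hBB v (2 * l + 3) hn hH huv hf π x).trans ?_
        have e : ∀ l : ℕ, (m : ℝ) * lam * (ρ ^ (2 * l + 3) / (β * m)) * N G H π =
            (lam * ρ ^ 3 / β * N G H π) * ρ ^ (2 * l) := by
          intro l; field_simp; ring
        simp only [e]
        rw [← mul_sum]
        refine (mul_le_mul_of_nonneg_left hge (by positivity)).trans ?_
        have e2 : lam * ρ ^ 3 / β * N G H π * (1 / (1 - ρ ^ 2)) =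
          (lam * ρ ^ 3 / (β * (1 - ρ ^ 2))) * N G H π := by field_simp
        rw [e2]
        have : lam * ρ ^ 3 / (β * (1 - ρ ^ 2)) ≤ z := by
          rw [div_le_iff₀ (by positivity)]; exact P.hzz
        gcongr

lemma N_pos (P : Par m K β ρ g lam z)
    (hdeg : ∀ v, (univ.filter fun w => G.Adj v w).card ≤ m + 1) (k : ℕ) :
    ∀ H : Finset (Sym2 V), H.card = k → (∀ e ∈ H, e ∈ G.edgeSet) →
    0 < N G H (fun _ => none : PCol V K) := by
  induction k with
  | zero =>
    intro H h0 _
    rw [card_eq_zero] at h0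
    subst h0
    refine Nat.cast_pos.2 (card_pos.2 ⟨fun _ => none, mem_Cls.2 ⟨fun _ _ => rfl, by simp, ?_, ?_⟩⟩)
    · exact ⟨by simp, by simp, by simp⟩
    · rintro ⟨k, p, c, d, _, _, _, h⟩
      have := (h 0).1
      simp at this
  | succ k ih =>
    intro H hc hH
    obtain ⟨f, hf⟩ : H.Nonempty := card_pos.1 (by omega)
    induction f with
    | _ u v =>
    have h1 := A_bound P hdeg (BB_all P hdeg H.card) le_rfl hH hf (fun _ => none) none
    have e : update (fun _ => none : PCol V K) s(u, v) none = fun _ => none := by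
      funext e; simp [update_apply]
    rw [e] at h1
    have h2 := ih (H.erase s(u, v)) (by rw [card_erase_of_mem hf]; omega)
      (fun e he => hH e (mem_of_mem_erase he))
    exact lt_of_lt_of_le (mul_pos P.b_pos h2) h1

lemma exists_coloring (P : Par m K β ρ g lam z)
    (hdeg : ∀ v, (univ.filter fun w => G.Adj v w).card ≤ m + 1) :
    ∃ φ : PCol V K, (∀ e ∈ G.edgeSet, φ e ≠ none) ∧ Good G φ ∧
      ¬ HasLong (univ.filter fun e => e ∈ G.edgeSet) φ := by
  have := N_pos (K := K) P hdeg _ (univ.filter fun e => e ∈ G.edgeSet) rfl (by simp)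
  obtain ⟨φ, hφ⟩ := card_pos.1 (Nat.cast_pos.1 this)
  obtain ⟨h1, h2, h3, h4⟩ := mem_Cls.1 hφ
  exact ⟨φ, fun e he => h2 e (by simpa using he), h3, h4⟩

end
lemma cycle_fun {G : SimpleGraph V} {v : V} {w : G.Walk v v} (hw : w.IsCycle) :
    ∃ p : ℤ → V, (∀ i, p (i + w.length) = p i) ∧ (∀ i j, p i = p j → (w.length : ℤ) ∣ i - j) ∧
      ∀ i, s(p i, p (i + 1)) ∈ w.edges := by
  have h3 := hw.three_le_length
  have hpos : (0 : ℤ) < w.length := by omega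
  refine ⟨fun i => w.getVert (i % w.length).toNat, ?_, ?_, ?_⟩
  · intro i
    simp
  · intro i j hij
    have h1 := Int.emod_nonneg i hpos.ne'
    have h2 := Int.emod_lt_of_pos i hpos
    have h4 := Int.emod_nonneg j hpos.ne'
    have h5 := Int.emod_lt_of_pos j hpos
    have := hw.getVert_injOn' (by simp only [Set.mem_ofPred_eq]; omega)
      (by simp only [Set.mem_ofPred_eq]; omega) hij
    have h6 : i % w.length = j % w.length := by omega
    exact Int.ModEq.dvd h6.symm
  · intro i
    have h1 := Int.emod_nonneg i hpos.ne'
    have h2 := Int.emod_lt_of_pos i hpos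
    obtain ⟨r, hr⟩ : ∃ r : ℕ, (r : ℤ) = i % w.length := ⟨(i % w.length).toNat, by omega⟩
    have hrn : r < w.length := by omega
    have e1 : w.getVert ((i + 1) % w.length).toNat = w.getVert (r + 1) := by
      rw [Int.add_emod, ← hr]
      by_cases hlt : r + 1 < w.length
      · congr 1
        rw [Int.emod_eq_of_lt (a := 1) (by omega) (by omega), Int.emod_eq_of_lt (by omega) (by omega)]
        omega
      · have : r + 1 = w.length := by omega
        have e : ((r : ℤ) + 1) = w.length := by omega
        rw [Int.emod_eq_of_lt (a := 1) (by omega) (by omega), e, this, w.getVert_length]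
        simp
    have e2 : w.getVert (i % w.length).toNat = w.getVert r := by rw [← hr]; simp
    show s(w.getVert (i % w.length).toNat, w.getVert ((i + 1) % w.length).toNat) ∈ w.edges
    rw [e1, e2]
    have hd : r < w.darts.length := by simpa using hrn
    have := w.darts_getElem_eq_getVert r hd
    unfold SimpleGraph.Walk.edges
    refine List.mem_map.2 ⟨w.darts[r], List.getElem_mem _, ?_⟩
    rw [this]
    rfl

lemma finish {G : SimpleGraph V} {φ : PCol V K} (hT : ∀ e ∈ G.edgeSet, φ e ≠ none)
    (hG : Good G φ) (hL : ¬ HasLong (univ.filter fun e => e ∈ G.edgeSet) φ) :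
    ∃ col : Sym2 V → ℕ, (∀ e ∈ G.edgeSet, col e < K) ∧ IsProperEdgeColoring G col ∧
      ∀ (v : V) (w : G.Walk v v), w.IsCycle → 3 ≤ (w.edges.map col).toFinset.card := by
  have hinj : ∀ e ∈ G.edgeSet, ∀ e' ∈ G.edgeSet,
      (φ e).elim 0 Fin.val = (φ e').elim 0 Fin.val → φ e = φ e' := by
    intro e he e' he' h
    obtain ⟨x, hx⟩ := Option.ne_none_iff_exists'.1 (hT e he)
    obtain ⟨y, hy⟩ := Option.ne_none_iff_exists'.1 (hT e' he')
    rw [hx, hy] at h ⊢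
    exact congrArg some (Fin.ext h)
  refine ⟨fun e => (φ e).elim 0 Fin.val, ?_, ?_, ?_⟩
  · intro e he
    obtain ⟨x, hx⟩ := Option.ne_none_iff_exists'.1 (hT e he)
    simp [hx]
  · rintro e he e' he' hne ⟨v, hv, hv'⟩ h
    have h := hinj e he e' he' h
    obtain ⟨a, rfl⟩ := hv
    obtain ⟨b, rfl⟩ := hv'
    obtain ⟨x, hx⟩ := Option.ne_none_iff_exists'.1 (hT _ he)
    rw [hx] at h
    exact hne (by rw [hG.proper v a b x hx h.symm])
  · intro v w hw
    obtain ⟨p, h1, h2, h3⟩ := cycle_fun hw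
    have hn3 := hw.three_le_length
    set n := w.length with hn
    have hE : ∀ i, s(p i, p (i + 1)) ∈ G.edgeSet := fun i => w.edges_subset_edgeSet (h3 i)
    by_contra hcard
    have hndvd : ∀ i, p i ≠ p (i + 2) := by
      intro i h
      have h4 := h2 _ _ h
      have : (n : ℤ) ∣ 2 := by
        have e : i - (i + 2) = -2 := by ring
        rw [e] at h4
        exact (dvd_neg.1 h4)
      have := Int.le_of_dvd (by norm_num) this
      omega
    choose C hC using fun i => Option.ne_none_iff_exists'.1 (hT _ (hE i))
    have hcons : ∀ i, C i ≠ C (i + 1) := by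
      intro i h
      have e1 := hC i
      have e2 := hC (i + 1)
      rw [← h] at e2
      rw [Sym2.eq_swap] at e1
      have := hG.proper _ _ _ _ e1 e2
      rw [add_assoc] at this
      exact hndvd i this
    have hmem : ∀ i, (C i : ℕ) ∈
        (w.edges.map fun e => (φ e).elim 0 Fin.val).toFinset := by
      intro i
      rw [List.mem_toFinset, List.mem_map]
      exact ⟨_, h3 i, by rw [hC i]; rfl⟩
    have hper : ∀ i, C (i + 2) = C i := by
      intro i
      by_contra hne
      apply hcard
      have : 2 < (w.edges.map fun e => (φ e).elim 0 Fin.val).toFinset.card := by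
        rw [Finset.two_lt_card_iff]
        refine ⟨C i, C (i + 1), C (i + 2), hmem _, hmem _, hmem _, ?_, ?_, ?_⟩
        · intro h; exact hcons i (Fin.ext h)
        · intro h; exact hne (Fin.ext h).symm
        · intro h
          have := hcons (i + 1)
          rw [add_assoc] at this
          exact this (Fin.ext h)
      exact this
    have hper2 : ∀ t i : ℤ, C (i + 2 * t) = C i := by
      intro t
      induction t using Int.induction_on with
      | zero => intro i; simp
      | succ t ih =>
        intro i
        rw [← ih i, ← hper (i + 2 * t)]
        congr 1; ring
      | pred t ih =>
        intro i
        rw [← ih i, ← hper (i + 2 * (-t - 1))]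
        congr 1; ring
    have hform : ∀ i : ℤ, C i = if Even i then C 0 else C 1 := by
      intro i
      rcases Int.even_or_odd' i with ⟨t, ht | ht⟩
      · have : Even i := ⟨t, by omega⟩
        rw [if_pos this, ← hper2 t 0, ht, zero_add]
      · have : ¬ Even i := by rw [Int.not_even_iff_odd]; exact ⟨t, ht⟩
        rw [if_neg this, ← hper2 t 1, ht, add_comm]
    have hCn : C n = C 0 := by
      have e1 := hC n
      have e0 := hC 0
      have k0 := h1 0
      have k1 := h1 1
      rw [zero_add] at k0
      rw [add_comm] at k1
      rw [k0, k1] at e1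
      rw [zero_add] at e0
      exact Option.some.inj (e1.symm.trans e0)
    have h01 : C 0 ≠ C 1 := hcons 0
    have heven : Even (n : ℤ) := by
      by_contra h
      rw [hform n, if_neg h] at hCn
      exact h01 hCn.symm
    obtain ⟨k, hk⟩ : ∃ k : ℕ, n = 2 * k := by
      obtain ⟨t, ht⟩ := heven
      exact ⟨t.toNat, by omega⟩
    rcases (by omega : k = 2 ∨ 3 ≤ k) with h | h
    · subst h
      have p4 : p 4 = p 0 := by
        have := h1 0
        rw [hk] at this
        simpa using this
      have e0 := hC 0
      have e1 := hC 1
      have e2 := hC 2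
      have e3 := hC 3
      norm_num at e0 e1 e2 e3
      rw [p4] at e3
      have c2 : C 2 = C 0 := hper 0
      have c3 : C 3 = C 1 := hper 1
      rw [c2] at e2
      rw [c3] at e3
      rcases hG.four _ _ _ _ _ _ e0 e1 e2 e3 with h | h
      · exact hndvd 0 h
      · exact hndvd 1 h
    · apply hL
      refine ⟨k, p, C 1, C 0, h, ?_, ?_, ?_⟩
      · intro i
        have := h1 i
        rw [hk] at this
        push_cast at this
        exact this
      · intro i j hij
        have := h2 i j hij
        rw [hk] at this
        push_cast at this
        exact this
      · intro i
        refine ⟨by simpa using hE i, ?_⟩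
        rw [hC i, ← hform i]

lemma small {G : SimpleGraph V} (hdeg : ∀ v, (univ.filter fun w => G.Adj v w).card ≤ 1) (k : ℕ) :
    ∃ φ : PCol V (k + 1), (∀ e ∈ G.edgeSet, φ e ≠ none) ∧ Good G φ ∧
      ¬ HasLong (univ.filter fun e => e ∈ G.edgeSet) φ := by
  have huniq : ∀ a b c, G.Adj a b → G.Adj a c → b = c := by
    intro a b c h1 h2
    exact Finset.card_le_one.1 (hdeg a) b (by simpa using h1) c (by simpa using h2)
  set φ : PCol V (k + 1) := fun e => if e ∈ G.edgeSet then some 0 else none with hφ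
  have hadj : ∀ e, φ e ≠ none → e ∈ G.edgeSet := by
    intro e he
    by_contra h
    exact he (by simp [hφ, h])
  have hadj2 : ∀ a b x, φ s(a, b) = some x → G.Adj a b := by
    intro a b x h
    exact hadj s(a, b) (by rw [h]; simp)
  refine ⟨φ, ?_, ⟨hadj, ?_, ?_⟩, ?_⟩
  · intro e he
    simp [hφ, he]
  · intro a b c x h1 h2
    exact huniq a b c (hadj2 _ _ _ h1) (hadj2 _ _ _ h2)
  · intro a b c d x y h1 h2 _ _
    exact Or.inl (huniq b a c (hadj2 _ _ _ h1).symm (hadj2 _ _ _ h2))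
  · rintro ⟨k, p, c, d, hk, h1, h2, h3⟩
    have e0 : G.Adj (p 0) (p 1) := by simpa using (h3 0).1
    have e1 : G.Adj (p 1) (p 2) := by simpa using (h3 1).1
    have h4 := h2 0 2 (huniq _ _ _ e0.symm e1)
    have h5 : (2 * k : ℤ) ∣ 2 := by simpa using h4
    have := Int.le_of_dvd (by norm_num) h5
    omega

lemma par_exists (m : ℕ) (hm : 1 ≤ m) :
    ∃ β ρ g lam z : ℝ, Par m (⌈(3.74 : ℝ) * m⌉₊ + 1) β ρ g lam z := by
  have hc := Nat.le_ceil ((3.74 : ℝ) * m)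
  have hm' : (1 : ℝ) ≤ m := by exact_mod_cast hm
  rcases (by omega : m = 1 ∨ m = 2 ∨ m = 3 ∨ m = 4 ∨ 5 ≤ m) with h | h | h | h | h
  · refine ⟨2, 0.5, 1, 1.5, 0.125, hm, by norm_num, by norm_num, by norm_num, by norm_num,
      by norm_num, by norm_num, by norm_num, by norm_num, by norm_num, ?_, ?_⟩
    · subst h
      have : 3 < ⌈(3.74 : ℝ) * (1 : ℕ)⌉₊ := Nat.lt_ceil.2 (by norm_num)
      have h2 : (4 : ℝ) ≤ (⌈(3.74 : ℝ) * (1 : ℕ)⌉₊ : ℝ) := by exact_mod_cast this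
      push_cast at h2 ⊢
      linarith
    · subst h; norm_num
  · refine ⟨1.6, 0.53, 0.4, 1.25, 0.162, hm, by norm_num, by norm_num, by norm_num, by norm_num,
      by norm_num, by norm_num, by norm_num, by norm_num, by norm_num, ?_, ?_⟩
    · subst h
      push_cast at hc ⊢
      linarith
    · subst h; norm_num
  · refine ⟨1.6, 0.53, 0.4, 1.25, 0.162, hm, by norm_num, by norm_num, by norm_num, by norm_num,
      by norm_num, by norm_num, by norm_num, by norm_num, by norm_num, ?_, ?_⟩
    · subst h
      push_cast at hc ⊢
      linarith
    · subst h; norm_num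
  · refine ⟨1.6, 0.53, 0.4, 1.25, 0.162, hm, by norm_num, by norm_num, by norm_num, by norm_num,
      by norm_num, by norm_num, by norm_num, by norm_num, by norm_num, ?_, ?_⟩
    · subst h
      have : 14 < ⌈(3.74 : ℝ) * (4 : ℕ)⌉₊ := Nat.lt_ceil.2 (by norm_num)
      have h2 : (15 : ℝ) ≤ (⌈(3.74 : ℝ) * (4 : ℕ)⌉₊ : ℝ) := by exact_mod_cast this
      push_cast at h2 ⊢
      linarith
    · subst h; norm_num
  · have h5 : (5 : ℝ) ≤ m := by exact_mod_cast h
    refine ⟨1.4, 0.48, 0.34, 1.243, 0.13, hm, by norm_num, by norm_num, by norm_num, by norm_num,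
      by norm_num, by norm_num, by norm_num, by norm_num, by norm_num, ?_, ?_⟩
    · push_cast
      linarith
    · linarith

lemma final {V : Type*} [Fintype V] [DecidableEq V] (G : SimpleGraph V) (Δ : ℕ)
    (hdeg : ∀ v, (univ.filter fun w => G.Adj v w).card ≤ Δ) :
    ∃ φ : PCol V (⌈(3.74 : ℝ) * ((Δ : ℝ) - 1)⌉₊ + 1), (∀ e ∈ G.edgeSet, φ e ≠ none) ∧ Good G φ ∧
      ¬ HasLong (univ.filter fun e => e ∈ G.edgeSet) φ := by
  by_cases h : Δ ≤ 1
  · exact small (fun v => (hdeg v).trans h) _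
  · obtain ⟨m, rfl⟩ : ∃ m, Δ = m + 1 := ⟨Δ - 1, by omega⟩
    obtain ⟨β, ρ, g, lam, z, P⟩ := par_exists m (by omega)
    have e : (((m + 1 : ℕ) : ℝ) - 1) = m := by push_cast; ring
    rw [e]
    exact exists_coloring P hdeg

end
end AEC

/-- Every finite simple graph of maximum degree at most `Δ` admits an acyclic
edge coloring with at most `⌈3.74(Δ-1)⌉ + 1` colors: a proper edge coloring in
which every cycle receives at least three distinct colors on its edges. -/
theorem acyclic_chromatic_index_bound {V : Type*} [Fintype V] [DecidableEq V]
    (G : SimpleGraph V) [DecidableRel G.Adj] (Δ : ℕ)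
    (hdeg : ∀ v, G.degree v ≤ Δ) :
    ∃ col : Sym2 V → ℕ,
      (∀ e ∈ G.edgeSet, col e < ⌈(3.74 : ℝ) * ((Δ : ℝ) - 1)⌉₊ + 1) ∧
      IsProperEdgeColoring G col ∧
      ∀ (v : V) (w : G.Walk v v), w.IsCycle →
        3 ≤ (w.edges.map col).toFinset.card := by
  have hdeg' : ∀ v, (Finset.univ.filter fun w => G.Adj v w).card ≤ Δ := by
    intro v
    have := hdeg v
    rwa [← SimpleGraph.card_neighborFinset_eq_degree, SimpleGraph.neighborFinset_eq_filter] at this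
  obtain ⟨φ, h1, h2, h3⟩ := AEC.final G Δ (by
    intro v
    convert hdeg' v)
  exact AEC.finish h1 h2 h3
end
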